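/- Let ρ: L^∞ → ℝ be a Fatou coherent risk measure with supporting set 𝒮_ρ. The following are equivalent: (i) there exists ρ̃: L^∞(𝓖) → ℝ such that ρ(X) = ρ̃(𝔼[X|𝓖]) for all X ∈ L^∞; (ii) ρ(X) = ρ(𝔼[X|𝓖]) for all X ∈ L^∞; (iii) every density D_μ with μ ∈ 𝒮_ρ is 𝓖-measurable. -/

import Mathlib

open MeasureTheory

/-- Membership in the supporting set of ρ (densities of probability measures ≪ ℙ);
boundedness of test random variables is required only almost everywhere. -/
def SuppMem {Ω : Type*} {mΩ : MeasurableSpace Ω} (ℙ : Measure Ω) (ρ : (Ω → ℝ) → ℝ)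
    (D : Ω → ℝ) : Prop :=
  Measurable D ∧ (∀ᵐ ω ∂ℙ, 0 ≤ D ω) ∧ Integrable D ℙ ∧ (∫ ω, D ω ∂ℙ) = 1 ∧
    ∀ X : Ω → ℝ, Measurable X → (∃ C : ℝ, ∀ᵐ ω ∂ℙ, |X ω| ≤ C) →
      (∫ ω, D ω * X ω ∂ℙ) ≤ ρ X

/-- In a Hilbert space, a decreasing sequence of nonempty closed convex sets, all contained in a
bounded set, has nonempty intersection. -/
theorem nonempty_iInter_of_antitone_convex {H : Type*} [NormedAddCommGroup H]
    [InnerProductSpace ℝ H] [CompleteSpace H] {C : ℕ → Set H} (hanti : Antitone C)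
    (hne : ∀ n, (C n).Nonempty) (hclosed : ∀ n, IsClosed (C n)) (hconv : ∀ n, Convex ℝ (C n))
    (hbdd : Bornology.IsBounded (C 0)) : (⋂ n, C n).Nonempty := by
  choose x hx hmin using fun n =>
    exists_norm_eq_iInf_of_complete_convex (hne n) (hclosed n).isComplete (hconv n) (0 : H)
  have hdist : ∀ k l, k ≤ l → ‖x l - x k‖ ^ 2 ≤ ‖x l‖ ^ 2 - ‖x k‖ ^ 2 := by
    intro k l hkl
    have h := (norm_eq_iInf_iff_real_inner_le_zero (hconv k) (hx k)).1 (hmin k) (x l)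
      (hanti hkl (hx l))
    rw [zero_sub, inner_neg_left, inner_sub_right, real_inner_self_eq_norm_sq] at h
    rw [norm_sub_sq_real, real_inner_comm]
    linarith
  have hmono : Monotone fun n => ‖x n‖ ^ 2 := fun k l hkl => by
    have := hdist k l hkl
    have := sq_nonneg ‖x l - x k‖
    simp only
    linarith
  obtain ⟨R, hR⟩ := hbdd.exists_norm_le
  have hub : BddAbove (Set.range fun n => ‖x n‖ ^ 2) := by
    refine ⟨R ^ 2, ?_⟩
    rintro _ ⟨n, rfl⟩
    exact pow_le_pow_left₀ (norm_nonneg _) (hR _ (hanti (Nat.zero_le n) (hx n))) 2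
  have hcau := (tendsto_atTop_ciSup hmono hub).cauchySeq
  have hxc : CauchySeq x := by
    rw [Metric.cauchySeq_iff'] at hcau ⊢
    intro ε hε
    obtain ⟨N, hN⟩ := hcau (ε ^ 2) (by positivity)
    refine ⟨N, fun n hn => ?_⟩
    have h1 := hN n hn
    rw [Real.dist_eq] at h1
    have h2 := (hdist N n hn).trans_lt ((le_abs_self _).trans_lt h1)
    rw [dist_eq_norm]
    exact lt_of_pow_lt_pow_left₀ 2 hε.le h2
  obtain ⟨a, ha⟩ := cauchySeq_tendsto_of_complete hxc
  refine ⟨a, Set.mem_iInter.2 fun n => (hclosed n).mem_of_tendsto ha ?_⟩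
  filter_upwards [Filter.eventually_ge_atTop n] with k hk using hanti hk (hx k)

open scoped Pointwise in
/-- In a Hilbert space, disjoint closed convex sets, one of which is bounded, can be separated
pointwise strictly by a linear functional. -/
theorem exists_inner_lt_inner_of_disjoint {H : Type*} [NormedAddCommGroup H]
    [InnerProductSpace ℝ H] [CompleteSpace H] {A B : Set H} (hA : Convex ℝ A)
    (hB : Convex ℝ B) (hAc : IsClosed A) (hBc : IsClosed B) (hAb : Bornology.IsBounded A)
    (hdisj : Disjoint A B) : ∃ z : H, ∀ a ∈ A, ∀ b ∈ B, inner ℝ z b < inner ℝ z a := by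
  have h0 : (0 : H) ∉ closure (A - B) := by
    intro h0
    have hne : (⋂ n : ℕ, A ∩ Metric.cthickening (1 / ((n : ℝ) + 1)) B).Nonempty := by
      refine nonempty_iInter_of_antitone_convex ?_ ?_ ?_ ?_ ?_
      · intro k l hkl
        exact Set.inter_subset_inter_right _
          (Metric.cthickening_mono (Nat.one_div_le_one_div hkl) B)
      · intro n
        obtain ⟨y, hy, hyd⟩ := Metric.mem_closure_iff.1 h0 (1 / ((n : ℝ) + 1)) (by positivity)
        obtain ⟨a, ha, b, hb, rfl⟩ := hy
        refine ⟨a, ha, Metric.mem_cthickening_of_dist_le a b _ _ hb ?_⟩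
        rw [dist_zero_left] at hyd
        rw [dist_eq_norm]
        exact hyd.le
      · exact fun n => hAc.inter Metric.isClosed_cthickening
      · exact fun n => hA.inter (hB.cthickening _)
      · exact hAb.subset Set.inter_subset_left
    obtain ⟨a, ha⟩ := hne
    rw [Set.mem_iInter] at ha
    refine Set.disjoint_left.1 hdisj (ha 0).1 ?_
    rw [← hBc.closure_eq, Metric.mem_closure_iff_infEDist_zero]
    refine le_antisymm (le_of_forall_pos_le_add ?_) bot_le
    intro ε hε
    rw [zero_add]
    by_cases htop : ε = ⊤
    · exact htop ▸ le_top
    obtain ⟨n, hn⟩ := exists_nat_one_div_lt (ENNReal.toReal_pos hε.ne' htop)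
    exact (ha n).2.trans (ENNReal.ofReal_le_of_le_toReal hn.le)
  obtain ⟨f, u, hfu, hub⟩ :=
    geometric_hahn_banach_point_closed (hA.sub hB).closure isClosed_closure h0
  refine ⟨(InnerProductSpace.toDual ℝ H).symm f, fun a ha b hb => ?_⟩
  have := hub (a - b) (subset_closure (Set.sub_mem_sub ha hb))
  rw [map_zero] at hfu
  rw [map_sub] at this
  simp only [InnerProductSpace.toDual_symm_apply]
  linarith

/-- The inner product of `L²` over the reals is the integral of the product. -/
theorem real_inner_Lp_two_eq_integral_mul {Ω : Type*} {mΩ : MeasurableSpace Ω} {ℙ : Measure Ω}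
    (f g : Lp ℝ 2 ℙ) : inner ℝ f g = ∫ ω, f ω * g ω ∂ℙ := by
  rw [L2.inner_def]
  exact integral_congr_ae (.of_forall fun ω => by simp [mul_comm])

theorem integrable_mul_Lp_two {Ω : Type*} {mΩ : MeasurableSpace Ω} {ℙ : Measure Ω}
    (f g : Lp ℝ 2 ℙ) : Integrable (fun ω => f ω * g ω) ℙ :=
  (Lp.memLp f).integrable_mul (Lp.memLp g)

theorem setOf_ae_mem_Icc_eq_Icc {Ω : Type*} {mΩ : MeasurableSpace Ω} {ℙ : Measure Ω}
    [IsFiniteMeasure ℙ] (r : ℝ) :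
    {V : Lp ℝ 2 ℙ | (∀ᵐ ω ∂ℙ, 0 ≤ V ω) ∧ ∀ᵐ ω ∂ℙ, V ω ≤ r} = Set.Icc 0 (Lp.const 2 ℙ r) := by
  ext V
  rw [Set.mem_Icc, ← Lp.coeFn_nonneg, ← Lp.coeFn_le]
  refine and_congr Iff.rfl ?_
  have hc : Lp.const 2 ℙ r =ᵐ[ℙ] Function.const Ω r := Lp.coeFn_const ..
  constructor
  · intro h
    filter_upwards [h, hc] with ω h1 h2
    rw [h2]
    exact h1
  · intro h
    filter_upwards [h, hc] with ω h1 h2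
    rw [h2] at h1
    exact h1

theorem convex_setOf_ae_mem_Icc {Ω : Type*} {mΩ : MeasurableSpace Ω} {ℙ : Measure Ω} (r : ℝ) :
    Convex ℝ {V : Lp ℝ 2 ℙ | (∀ᵐ ω ∂ℙ, 0 ≤ V ω) ∧ ∀ᵐ ω ∂ℙ, V ω ≤ r} := by
  rintro V ⟨hV0, hVr⟩ V' ⟨hV0', hVr'⟩ a b ha hb hab
  have h : ∀ᵐ ω ∂ℙ, (a • V + b • V' : Lp ℝ 2 ℙ) ω = a * V ω + b * V' ω := by
    filter_upwards [Lp.coeFn_add (a • V) (b • V'), Lp.coeFn_smul a V, Lp.coeFn_smul b V']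
      with ω h1 h2 h3
    rw [h1, Pi.add_apply, h2, h3]
    rfl
  constructor
  · filter_upwards [h, hV0, hV0'] with ω h h1 h2
    rw [h]
    positivity
  · filter_upwards [h, hVr, hVr'] with ω h h1 h2
    rw [h]
    calc a * V ω + b * V' ω ≤ a * r + b * r := by gcongr
      _ = r := by rw [← add_mul, hab, one_mul]

theorem isBounded_setOf_ae_mem_Icc {Ω : Type*} {mΩ : MeasurableSpace Ω} {ℙ : Measure Ω}
    [IsFiniteMeasure ℙ] (r : ℝ) :
    Bornology.IsBounded {V : Lp ℝ 2 ℙ | (∀ᵐ ω ∂ℙ, 0 ≤ V ω) ∧ ∀ᵐ ω ∂ℙ, V ω ≤ r} := by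
  rw [setOf_ae_mem_Icc_eq_Icc, isBounded_iff_forall_norm_le]
  refine ⟨‖Lp.const 2 ℙ r‖, fun V hV => ?_⟩
  refine HasSolidNorm.solid ?_
  rw [abs_of_nonneg hV.1, abs_of_nonneg (hV.1.trans hV.2)]
  exact hV.2

/-- A nonnegative weight that is larger than one on the part of `K` below the level `R` which is
not already detected by `S`, while its mean is at most `1 / r`. -/
theorem exists_nonneg_separating_of_box {Ω : Type*} {mΩ : MeasurableSpace Ω} {ℙ : Measure Ω}
    [IsFiniteMeasure ℙ] {K : Set (Lp ℝ 2 ℙ)} (hconv : Convex ℝ K)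
    (hnn : ∀ U ∈ K, ∀ᵐ ω ∂ℙ, 0 ≤ U ω)
    (hcl : ∀ r : ℝ, IsClosed {U ∈ K | ∀ᵐ ω ∂ℙ, U ω ≤ r}) {r : ℝ} (hr : 0 < r) (R : ℝ)
    (S : Lp ℝ 2 ℙ) (hS : ∀ U ∈ K, (∀ᵐ ω ∂ℙ, U ω ≤ r) → 1 < inner ℝ S U) :
    ∃ Z : Lp ℝ 2 ℙ, (∀ᵐ ω ∂ℙ, 0 ≤ Z ω) ∧ ∫ ω, Z ω ∂ℙ ≤ 1 / r ∧
      ∀ U ∈ K, (∀ᵐ ω ∂ℙ, U ω ≤ R) → inner ℝ S U ≤ 1 → 1 < inner ℝ Z U := by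
  set A : Set (Lp ℝ 2 ℙ) := {U ∈ K | ∀ᵐ ω ∂ℙ, U ω ≤ R} ∩ {U | inner ℝ S U ≤ 1} with hAdef
  set B : Set (Lp ℝ 2 ℙ) := {V | (∀ᵐ ω ∂ℙ, 0 ≤ V ω) ∧ ∀ᵐ ω ∂ℙ, V ω ≤ r} with hBdef
  have hKR : {U ∈ K | ∀ᵐ ω ∂ℙ, U ω ≤ R} =
      K ∩ {V | (∀ᵐ ω ∂ℙ, 0 ≤ V ω) ∧ ∀ᵐ ω ∂ℙ, V ω ≤ R} := by
    ext U
    exact ⟨fun h => ⟨h.1, hnn U h.1, h.2⟩, fun h => ⟨h.1, h.2.2⟩⟩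
  obtain ⟨z, hz⟩ : ∃ z : Lp ℝ 2 ℙ, ∀ a ∈ A, ∀ b ∈ B, inner ℝ z b < inner ℝ z a := by
    refine exists_inner_lt_inner_of_disjoint ?_ (convex_setOf_ae_mem_Icc r) ?_ ?_ ?_ ?_
    · refine Convex.inter ?_ ?_
      · rw [hKR]
        exact hconv.inter (convex_setOf_ae_mem_Icc R)
      · exact convex_halfSpace_le (innerSL ℝ S).isLinear 1
    · exact (hcl R).inter (isClosed_le (innerSL ℝ S).continuous continuous_const)
    · rw [hBdef, setOf_ae_mem_Icc_eq_Icc]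
      exact isClosed_Icc
    · refine (isBounded_setOf_ae_mem_Icc (ℙ := ℙ) R).subset ?_
      rw [hAdef, hKR]
      exact fun U hU => hU.1.2
    · rw [Set.disjoint_left]
      intro U hUA hUB
      exact absurd (hS U hUA.1.1 hUB.2) (not_lt.2 hUA.2)
  by_cases hAne : A.Nonempty
  swap
  · refine ⟨0, ?_, ?_, fun U hU hUR hUS => absurd ⟨U, ⟨hU, hUR⟩, hUS⟩ hAne⟩
    · filter_upwards [Lp.coeFn_zero ℝ 2 ℙ] with ω h
      rw [h]
      rfl
    · rw [integral_congr_ae (Lp.coeFn_zero ℝ 2 ℙ)]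
      simp [hr.le]
  have hzm : Measurable z := (Lp.stronglyMeasurable z).measurable
  have hs : MeasurableSet {ω | 0 < z ω} := measurableSet_lt measurable_const hzm
  have hpos : Lp.posPart z =ᵐ[ℙ] fun ω => max (z ω) 0 := Lp.coeFn_posPart z
  set a : ℝ := r * ∫ ω, max (z ω) 0 ∂ℙ with ha
  have hVB : indicatorConstLp 2 hs (measure_ne_top ℙ _) r ∈ B := by
    have h := indicatorConstLp_coeFn (p := 2) (hs := hs) (hμs := measure_ne_top ℙ _) (c := r)
    constructor <;>
    · filter_upwards [h] with ω h
      rw [h, Set.indicator_apply]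
      split_ifs <;> simp [hr.le]
  have hzV : inner ℝ z (indicatorConstLp 2 hs (measure_ne_top ℙ _) r) = a := by
    rw [real_inner_Lp_two_eq_integral_mul, ha, ← integral_const_mul]
    refine integral_congr_ae ?_
    filter_upwards [indicatorConstLp_coeFn (p := 2) (hs := hs) (hμs := measure_ne_top ℙ _)
      (c := r)] with ω h
    rw [h, Set.indicator_apply]
    split_ifs with hω
    · rw [max_eq_left (le_of_lt hω), mul_comm]
    · rw [max_eq_right (not_lt.1 hω), mul_zero, mul_zero]
  have hzU : ∀ U ∈ A, a < inner ℝ (Lp.posPart z) U := by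
    intro U hU
    refine (hzV ▸ hz U hU _ hVB).trans_le ?_
    rw [real_inner_Lp_two_eq_integral_mul, real_inner_Lp_two_eq_integral_mul]
    refine integral_mono_ae (integrable_mul_Lp_two _ _) (integrable_mul_Lp_two _ _) ?_
    filter_upwards [hpos, hnn U hU.1.1] with ω h1 h2
    rw [h1]
    exact mul_le_mul_of_nonneg_right (le_max_left _ _) h2
  have ha0 : 0 ≤ a := mul_nonneg hr.le (integral_nonneg fun ω => le_max_right _ _)
  have ha1 : 0 < a := by
    refine lt_of_le_of_ne ha0 fun h => ?_
    have hI : ∫ ω, max (z ω) 0 ∂ℙ = 0 := by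
      rcases mul_eq_zero.1 h.symm with h | h
      · exact absurd h hr.ne'
      · exact h
    have hint : Integrable (fun ω => max (z ω) 0) ℙ :=
      ((Lp.memLp (Lp.posPart z)).integrable (by norm_num)).congr hpos
    have h0 := (integral_eq_zero_iff_of_nonneg (fun ω => le_max_right _ _) hint).1 hI
    obtain ⟨U, hU⟩ := hAne
    have := hzU U hU
    rw [real_inner_Lp_two_eq_integral_mul, integral_eq_zero_of_ae] at this
    · exact this.not_ge ha0
    · filter_upwards [hpos, h0] with ω h1 h2
      have h3 : max (z ω) 0 = 0 := h2
      rw [h1, h3, zero_mul]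
      rfl
  have hsm := Lp.coeFn_smul a⁻¹ (Lp.posPart z)
  refine ⟨a⁻¹ • Lp.posPart z, ?_, ?_, ?_⟩
  · filter_upwards [hsm, hpos] with ω h1 h2
    rw [h1, Pi.smul_apply, h2, smul_eq_mul]
    positivity
  · rw [integral_congr_ae hsm]
    simp only [Pi.smul_apply, smul_eq_mul]
    rw [integral_const_mul, integral_congr_ae hpos, le_div_iff₀ hr, mul_assoc, mul_comm _ r, ← ha,
      inv_mul_cancel₀ ha1.ne']
  · intro U hU hUR hUS
    rw [real_inner_smul_left, inv_mul_eq_div, one_lt_div ha1]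
    exact hzU U ⟨⟨hU, hUR⟩, hUS⟩

/-- A Krein–Šmulian type statement: if `K` is a convex set of nonnegative functions whose bounded
parts are closed in `L²` and which stays away from zero, then a single integrable weight detects
all bounded elements of `K`. -/
theorem exists_integrable_weight {Ω : Type*} {mΩ : MeasurableSpace Ω} {ℙ : Measure Ω}
    [IsFiniteMeasure ℙ] {K : Set (Lp ℝ 2 ℙ)} (hconv : Convex ℝ K)
    (hnn : ∀ U ∈ K, ∀ᵐ ω ∂ℙ, 0 ≤ U ω)
    (hcl : ∀ r : ℝ, IsClosed {U ∈ K | ∀ᵐ ω ∂ℙ, U ω ≤ r}) {r : ℝ} (hr : 0 < r)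
    (hK : ∀ U ∈ K, ¬ ∀ᵐ ω ∂ℙ, U ω ≤ r) :
    ∃ W : Ω → ℝ, Measurable W ∧ (∀ ω, 0 ≤ W ω) ∧ Integrable W ℙ ∧
      ∀ U ∈ K, (∃ C : ℝ, ∀ᵐ ω ∂ℙ, U ω ≤ C) → 1 ≤ ∫ ω, W ω * U ω ∂ℙ := by
  have hrn : ∀ n : ℕ, 0 < r * 2 ^ n := fun n => by positivity
  have hstep : ∀ (n : ℕ) (S : Lp ℝ 2 ℙ), ∃ Z : Lp ℝ 2 ℙ,
      (∀ U ∈ K, (∀ᵐ ω ∂ℙ, U ω ≤ r * 2 ^ n) → 1 < inner ℝ S U) →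
      (∀ᵐ ω ∂ℙ, 0 ≤ Z ω) ∧ ∫ ω, Z ω ∂ℙ ≤ 1 / (r * 2 ^ n) ∧
      ∀ U ∈ K, (∀ᵐ ω ∂ℙ, U ω ≤ r * 2 ^ (n + 1)) → inner ℝ S U ≤ 1 → 1 < inner ℝ Z U := by
    intro n S
    by_cases h : ∀ U ∈ K, (∀ᵐ ω ∂ℙ, U ω ≤ r * 2 ^ n) → 1 < inner ℝ S U
    · obtain ⟨Z, hZ⟩ :=
        exists_nonneg_separating_of_box hconv hnn hcl (hrn n) (r * 2 ^ (n + 1)) S h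
      exact ⟨Z, fun _ => hZ⟩
    · exact ⟨0, fun h' => absurd h' h⟩
  choose F hF using hstep
  let S : ℕ → Lp ℝ 2 ℙ := fun n => Nat.rec 0 (fun n S => S + F n S) n
  let Z : ℕ → Lp ℝ 2 ℙ := fun n => F n (S n)
  have hSsucc : ∀ n, S (n + 1) = S n + Z n := fun n => rfl
  have inner_nonneg : ∀ V : Lp ℝ 2 ℙ, (∀ᵐ ω ∂ℙ, 0 ≤ V ω) → ∀ U ∈ K, 0 ≤ inner ℝ V U := by
    intro V hV U hU
    rw [real_inner_Lp_two_eq_integral_mul]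
    refine integral_nonneg_of_ae ?_
    filter_upwards [hV, hnn U hU] with ω h1 h2 using mul_nonneg h1 h2
  have hS' : ∀ n, (∀ᵐ ω ∂ℙ, 0 ≤ S n ω) ∧
      ∀ U ∈ K, (∀ᵐ ω ∂ℙ, U ω ≤ r * 2 ^ n) → 1 < inner ℝ (S n) U := by
    intro n
    induction n with
    | zero =>
      refine ⟨?_, fun U hU hUr => absurd (by simpa using hUr) (hK U hU)⟩
      filter_upwards [Lp.coeFn_zero ℝ 2 ℙ] with ω h using h.ge
    | succ n ih =>
      obtain ⟨hZ0, -, hZ⟩ := hF n (S n) ih.2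
      refine ⟨?_, fun U hU hUr => ?_⟩
      · filter_upwards [ih.1, hZ0, Lp.coeFn_add (S n) (Z n)] with ω h1 h2 h3
        rw [hSsucc, h3]
        exact add_nonneg h1 h2
      · have hZU := inner_nonneg (Z n) hZ0 U hU
        have hSU := inner_nonneg (S n) ih.1 U hU
        rw [hSsucc, inner_add_left]
        by_cases h : inner ℝ (S n) U ≤ 1
        · have h1 : 1 < inner ℝ (Z n) U := hZ U hU hUr h
          linarith
        · linarith [not_le.1 h]
  have hS := fun n => (hS' n).2
  have hZ0 : ∀ n, ∀ᵐ ω ∂ℙ, 0 ≤ Z n ω := fun n => (hF n (S n) (hS n)).1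
  have hZint : ∀ n, ∫ ω, Z n ω ∂ℙ ≤ 1 / (r * 2 ^ n) := fun n => (hF n (S n) (hS n)).2.1
  have hZm : ∀ n, Measurable fun ω => ENNReal.ofReal (Z n ω) := fun n =>
    (Lp.stronglyMeasurable (Z n)).measurable.ennreal_ofReal
  let G : Ω → ENNReal := fun ω => ∑' n, ENNReal.ofReal (Z n ω)
  have hGm : Measurable G := Measurable.tsum hZm
  have hGfin : ∫⁻ ω, G ω ∂ℙ ≠ ⊤ := by
    have hsum : Summable fun n : ℕ => 1 / (r * 2 ^ n) := by
      have := (summable_geometric_two).mul_left (1 / r)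
      refine this.congr fun n => ?_
      rw [div_mul_eq_div_div, one_div_pow]
      ring
    rw [lintegral_tsum fun n => (hZm n).aemeasurable]
    refine ne_top_of_le_ne_top hsum.tsum_ofReal_ne_top (ENNReal.tsum_le_tsum fun n => ?_)
    rw [← ofReal_integral_eq_lintegral_ofReal ((Lp.memLp (Z n)).integrable (by norm_num)) (hZ0 n)]
    exact ENNReal.ofReal_le_ofReal (hZint n)
  have hWint : Integrable (fun ω => (G ω).toReal) ℙ :=
    integrable_toReal_of_lintegral_ne_top hGm.aemeasurable hGfin
  refine ⟨fun ω => (G ω).toReal, hGm.ennreal_toReal, fun ω => ENNReal.toReal_nonneg, hWint, ?_⟩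
  rintro U hU ⟨C, hC⟩
  have hSW : ∀ n, ∀ᵐ ω ∂ℙ, S n ω ≤ (G ω).toReal := by
    intro n
    have hSsum : ∀ᵐ ω ∂ℙ, S n ω = ∑ i ∈ Finset.range n, Z i ω := by
      induction n with
      | zero =>
        filter_upwards [Lp.coeFn_zero ℝ 2 ℙ] with ω h
        exact h
      | succ n ih =>
        filter_upwards [ih, Lp.coeFn_add (S n) (Z n)] with ω h1 h2
        rw [Finset.sum_range_succ, ← h1, hSsucc, h2, Pi.add_apply]
    filter_upwards [hSsum, ae_lt_top hGm hGfin, ae_all_iff.2 hZ0] with ω h1 h2 h3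
    rw [h1, ← ENNReal.ofReal_le_iff_le_toReal h2.ne, ENNReal.ofReal_sum_of_nonneg fun i _ => h3 i]
    exact ENNReal.sum_le_tsum _
  obtain ⟨n, hn⟩ : ∃ n : ℕ, C ≤ r * 2 ^ n := by
    obtain ⟨n, hn⟩ := pow_unbounded_of_one_lt (C / r) (one_lt_two)
    exact ⟨n, by rw [mul_comm]; exact (div_le_iff₀ hr).1 hn.le⟩
  refine (hS n U hU (hC.mono fun ω h => h.trans hn)).le.trans ?_
  rw [real_inner_Lp_two_eq_integral_mul]
  refine integral_mono_ae (integrable_mul_Lp_two _ _) ?_ ?_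
  · refine hWint.mul_bdd (c := C) (Lp.aestronglyMeasurable U) ?_
    filter_upwards [hC, hnn U hU] with ω h1 h2
    rwa [Real.norm_of_nonneg h2]
  · filter_upwards [hSW n, hnn U hU] with ω h1 h2
    exact mul_le_mul_of_nonneg_right h1 h2

/-- Measurable and almost surely bounded random variables. -/
def IsMeasBdd {Ω : Type*} {mΩ : MeasurableSpace Ω} (ℙ : Measure Ω) (X : Ω → ℝ) : Prop :=
  Measurable X ∧ ∃ C : ℝ, ∀ᵐ ω ∂ℙ, |X ω| ≤ C

/-- Fatou coherent risk measures on almost surely bounded random variables. -/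
structure IsFatouCoherent {Ω : Type*} {mΩ : MeasurableSpace Ω} (ℙ : Measure Ω)
    (ρ : (Ω → ℝ) → ℝ) : Prop where
  congr_ae : ∀ X Y : Ω → ℝ, X =ᵐ[ℙ] Y → ρ X = ρ Y
  add_const : ∀ (X : Ω → ℝ) (c : ℝ), IsMeasBdd ℙ X → ρ (fun ω => X ω + c) = ρ X + c
  mono : ∀ X Y : Ω → ℝ, IsMeasBdd ℙ X → IsMeasBdd ℙ Y → (∀ᵐ ω ∂ℙ, X ω ≤ Y ω) → ρ X ≤ ρ Y
  convex : ∀ X Y : Ω → ℝ, IsMeasBdd ℙ X → IsMeasBdd ℙ Y → ∀ lam : ℝ, 0 ≤ lam → lam ≤ 1 →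
    ρ (fun ω => lam * X ω + (1 - lam) * Y ω) ≤ lam * ρ X + (1 - lam) * ρ Y
  const_mul : ∀ X : Ω → ℝ, IsMeasBdd ℙ X → ∀ lam : ℝ, 0 ≤ lam →
    ρ (fun ω => lam * X ω) = lam * ρ X
  fatou : ∀ (Xs : ℕ → Ω → ℝ) (X : Ω → ℝ) (C : ℝ), (∀ n, Measurable (Xs n)) →
    (∀ n ω, |Xs n ω| ≤ C) → Measurable X → (∀ ω, |X ω| ≤ C) →
    (∀ᵐ ω ∂ℙ, Filter.Tendsto (fun n => Xs n ω) Filter.atTop (nhds (X ω))) →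
    ρ X ≤ Filter.liminf (fun n => ρ (Xs n)) Filter.atTop

namespace IsMeasBdd

variable {Ω : Type*} {mΩ : MeasurableSpace Ω} {ℙ : Measure Ω} {X Y : Ω → ℝ}

theorem const (c : ℝ) : IsMeasBdd ℙ (fun _ => c) :=
  ⟨measurable_const, |c|, .of_forall fun _ => le_rfl⟩

theorem add (hX : IsMeasBdd ℙ X) (hY : IsMeasBdd ℙ Y) : IsMeasBdd ℙ (fun ω => X ω + Y ω) := by
  obtain ⟨hXm, C, hC⟩ := hX
  obtain ⟨hYm, D, hD⟩ := hY
  refine ⟨hXm.add hYm, C + D, ?_⟩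
  filter_upwards [hC, hD] with ω h1 h2 using (abs_add_le _ _).trans (add_le_add h1 h2)

theorem const_mul (hX : IsMeasBdd ℙ X) (c : ℝ) : IsMeasBdd ℙ (fun ω => c * X ω) := by
  obtain ⟨hXm, C, hC⟩ := hX
  refine ⟨hXm.const_mul c, |c| * C, ?_⟩
  filter_upwards [hC] with ω h
  rw [abs_mul]
  exact mul_le_mul_of_nonneg_left h (abs_nonneg c)

theorem sub (hX : IsMeasBdd ℙ X) (hY : IsMeasBdd ℙ Y) : IsMeasBdd ℙ (fun ω => X ω - Y ω) := by
  simpa [sub_eq_add_neg] using hX.add (hY.const_mul (-1))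

theorem posPart (hX : IsMeasBdd ℙ X) : IsMeasBdd ℙ (fun ω => max (X ω) 0) := by
  obtain ⟨hXm, C, hC⟩ := hX
  refine ⟨hXm.max measurable_const, C, ?_⟩
  filter_upwards [hC] with ω h
  rw [abs_of_nonneg (le_max_right _ _)]
  exact max_le ((le_abs_self _).trans h) ((abs_nonneg _).trans h)

theorem memLp_mul {p : ENNReal} (hX : IsMeasBdd ℙ X) {f : Ω → ℝ} (hf : MemLp f p ℙ) :
    MemLp (fun ω => f ω * X ω) p ℙ := by
  obtain ⟨hXm, C, hC⟩ := hX
  refine hf.of_le_mul (c := C) (hf.1.mul hXm.aestronglyMeasurable) ?_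
  filter_upwards [hC] with ω h
  rw [norm_mul, mul_comm]
  exact mul_le_mul_of_nonneg_right h (norm_nonneg _)

theorem integrable_mul (hX : IsMeasBdd ℙ X) {f : Ω → ℝ} (hf : Integrable f ℙ) :
    Integrable (fun ω => f ω * X ω) ℙ :=
  memLp_one_iff_integrable.1 (hX.memLp_mul (memLp_one_iff_integrable.2 hf))

theorem memLp [IsFiniteMeasure ℙ] (hX : IsMeasBdd ℙ X) (p : ENNReal) : MemLp X p ℙ := by
  obtain ⟨hXm, C, hC⟩ := hX
  exact MemLp.of_bound hXm.aestronglyMeasurable C hC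

theorem of_Lp {p : ENNReal} {U : Lp ℝ p ℙ} {r : ℝ} (h0 : ∀ᵐ ω ∂ℙ, 0 ≤ U ω)
    (hr : ∀ᵐ ω ∂ℙ, U ω ≤ r) : IsMeasBdd ℙ U := by
  refine ⟨(Lp.stronglyMeasurable U).measurable, r, ?_⟩
  filter_upwards [h0, hr] with ω h1 h2
  rwa [abs_of_nonneg h1]

end IsMeasBdd

namespace IsFatouCoherent

variable {Ω : Type*} {mΩ : MeasurableSpace Ω} {ℙ : Measure Ω} {ρ : (Ω → ℝ) → ℝ}

theorem const (hρ : IsFatouCoherent ℙ ρ) (c : ℝ) : ρ (fun _ => c) = c := by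
  have h0 : ρ (fun _ => 0) = 0 := by
    simpa using hρ.const_mul (fun _ => 0) (IsMeasBdd.const 0) 0 le_rfl
  simpa [h0] using hρ.add_const (fun _ => 0) c (IsMeasBdd.const 0)

/-- Acceptability is preserved under dominated almost sure convergence. -/
theorem nonpos_of_tendsto (hρ : IsFatouCoherent ℙ ρ) {Xs : ℕ → Ω → ℝ} {X : Ω → ℝ} {C : ℝ}
    (hXs : ∀ n, Measurable (Xs n)) (hC : ∀ n, ∀ᵐ ω ∂ℙ, |Xs n ω| ≤ C) (hX : Measurable X)
    (hlim : ∀ᵐ ω ∂ℙ, Filter.Tendsto (fun n => Xs n ω) Filter.atTop (nhds (X ω)))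
    (h : ∀ n, ρ (Xs n) ≤ 0) : ρ X ≤ 0 := by
  let cl : ℝ → ℝ := fun x => max (-|C|) (min |C| x)
  have hclc : Continuous cl := continuous_const.max (continuous_const.min continuous_id)
  have hcl : ∀ x, |x| ≤ C → cl x = x := by
    intro x hx
    have h1 := abs_le.1 (hx.trans (le_abs_self C))
    simp only [cl]
    rw [min_eq_right h1.2, max_eq_right h1.1]
  have hclb : ∀ x, |cl x| ≤ |C| := fun x =>
    abs_le.2 ⟨le_max_left _ _,
      max_le (neg_le_self (abs_nonneg C)) (min_le_left _ _)⟩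
  have hXC : ∀ᵐ ω ∂ℙ, |X ω| ≤ C := by
    filter_upwards [ae_all_iff.2 hC, hlim] with ω h1 h2
    exact le_of_tendsto' h2.abs h1
  have hb : ∀ n, IsMeasBdd ℙ (fun ω => cl (Xs n ω)) := fun n =>
    ⟨hclc.measurable.comp (hXs n), |C|, .of_forall fun ω => hclb _⟩
  have hneg : ∀ n, ρ (fun ω => cl (Xs n ω)) ≤ 0 := fun n => by
    rw [hρ.congr_ae (fun ω => cl (Xs n ω)) (Xs n) ((hC n).mono fun ω hω => hcl _ hω)]
    exact h n
  have hlow : ∀ n, -|C| ≤ ρ (fun ω => cl (Xs n ω)) := fun n => by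
    rw [← hρ.const (-|C|)]
    exact hρ.mono _ _ (IsMeasBdd.const _) (hb n) (.of_forall fun ω => le_max_left _ _)
  rw [hρ.congr_ae X (fun ω => cl (X ω)) (hXC.mono fun ω hω => (hcl _ hω).symm)]
  refine (hρ.fatou (fun n ω => cl (Xs n ω)) (fun ω => cl (X ω)) |C| (fun n => (hb n).1)
    (fun n ω => hclb _) (hclc.measurable.comp hX) (fun ω => hclb _) ?_).trans ?_
  · filter_upwards [hlim] with ω hω
    exact (hclc.tendsto _).comp hω
  · exact Filter.liminf_le_of_frequently_le (.of_forall hneg)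
      (Filter.isBoundedUnder_of ⟨_, hlow⟩)

/-- If `X` is not acceptable, there is an integrable weight for which the weighted `L¹` distance
of `X` to the acceptable positions is at least one. -/
theorem exists_weight [IsProbabilityMeasure ℙ] (hρ : IsFatouCoherent ℙ ρ) {X : Ω → ℝ}
    (hX : IsMeasBdd ℙ X) (hpos : 0 < ρ X) :
    ∃ W : Ω → ℝ, Measurable W ∧ (∀ ω, 0 ≤ W ω) ∧ Integrable W ℙ ∧
      ∀ Y : Ω → ℝ, IsMeasBdd ℙ Y → ρ Y ≤ 0 → 1 ≤ ∫ ω, W ω * max (X ω - Y ω) 0 ∂ℙ := by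
  let K : Set (Lp ℝ 2 ℙ) := {U | (∀ᵐ ω ∂ℙ, 0 ≤ U ω) ∧ (∃ r : ℝ, ∀ᵐ ω ∂ℙ, U ω ≤ r) ∧
    ρ (fun ω => X ω - U ω) ≤ 0}
  have hsub : ∀ U ∈ K, IsMeasBdd ℙ (fun ω => X ω - U ω) := by
    rintro U ⟨h0, ⟨r, hr⟩, -⟩
    exact hX.sub (IsMeasBdd.of_Lp h0 hr)
  have hconv : Convex ℝ K := by
    intro U hU V hV a b ha hb hab
    obtain ⟨hU0, ⟨r, hr⟩, hUρ⟩ := id hU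
    obtain ⟨hV0, ⟨s, hs⟩, hVρ⟩ := id hV
    have hc := convex_setOf_ae_mem_Icc (ℙ := ℙ) (max r s)
      ⟨hU0, hr.mono fun ω h => h.trans (le_max_left r s)⟩
      ⟨hV0, hs.mono fun ω h => h.trans (le_max_right r s)⟩ ha hb hab
    refine ⟨hc.1, ⟨_, hc.2⟩, ?_⟩
    have h := hρ.convex _ _ (hsub U hU) (hsub V hV) a ha (by linarith)
    obtain rfl : b = 1 - a := by linarith
    rw [hρ.congr_ae _ (fun ω => a * (X ω - U ω) + (1 - a) * (X ω - V ω))]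
    · refine h.trans (add_nonpos ?_ ?_)
      · exact mul_nonpos_of_nonneg_of_nonpos ha hUρ
      · exact mul_nonpos_of_nonneg_of_nonpos hb hVρ
    · filter_upwards [Lp.coeFn_add (a • U) ((1 - a) • V), Lp.coeFn_smul a U,
        Lp.coeFn_smul (1 - a) V] with ω h1 h2 h3
      rw [h1, Pi.add_apply, h2, h3, Pi.smul_apply, Pi.smul_apply, smul_eq_mul, smul_eq_mul]
      ring
  have hcl : ∀ r : ℝ, IsClosed {U ∈ K | ∀ᵐ ω ∂ℙ, U ω ≤ r} := by
    intro r
    refine IsSeqClosed.isClosed fun U V hU hlim => ?_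
    have hV : V ∈ {V : Lp ℝ 2 ℙ | (∀ᵐ ω ∂ℙ, 0 ≤ V ω) ∧ ∀ᵐ ω ∂ℙ, V ω ≤ r} := by
      rw [setOf_ae_mem_Icc_eq_Icc]
      refine isClosed_Icc.mem_of_tendsto hlim (.of_forall fun n => ?_)
      rw [← setOf_ae_mem_Icc_eq_Icc]
      exact ⟨(hU n).1.1, (hU n).2⟩
    obtain ⟨φ, -, hφ⟩ := (tendstoInMeasure_of_tendsto_Lp hlim).exists_seq_tendsto_ae
    obtain ⟨C, hC⟩ := hX.2
    refine ⟨⟨hV.1, ⟨r, hV.2⟩, ?_⟩, hV.2⟩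
    refine hρ.nonpos_of_tendsto (Xs := fun n ω => X ω - U (φ n) ω) (C := C + r)
      (fun n => (hsub _ (hU (φ n)).1).1) (fun n => ?_)
      (hX.sub (IsMeasBdd.of_Lp hV.1 hV.2)).1 ?_ fun n => (hU (φ n)).1.2.2
    · filter_upwards [hC, (hU (φ n)).1.1, (hU (φ n)).2] with ω h1 h2 h3
      refine (abs_sub _ _).trans (add_le_add h1 ?_)
      rwa [abs_of_nonneg h2]
    · filter_upwards [hφ] with ω hω using tendsto_const_nhds.sub hω
  obtain ⟨W, hWm, hW0, hWi, hW⟩ := exists_integrable_weight hconv (fun U hU => hU.1) hcl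
    (half_pos hpos) (by
      intro U hU hUr
      have h1 : ρ X ≤ ρ (fun ω => X ω - U ω + ρ X / 2) := by
        refine hρ.mono _ _ hX ((hsub U hU).add (IsMeasBdd.const _)) ?_
        filter_upwards [hUr] with ω h
        linarith
      rw [hρ.add_const _ _ (hsub U hU)] at h1
      linarith [hU.2.2])
  refine ⟨W, hWm, hW0, hWi, fun Y hY hρY => ?_⟩
  have hP := (hX.sub hY).posPart
  have hL := (hP.memLp 2).coeFn_toLp
  obtain ⟨C, hC⟩ := hP.2
  have hbd : ∀ᵐ ω ∂ℙ, (hP.memLp 2).toLp _ ω ≤ C := by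
    filter_upwards [hL, hC] with ω h1 h2
    rw [h1]
    exact (le_abs_self _).trans h2
  have h0 : ∀ᵐ ω ∂ℙ, 0 ≤ (hP.memLp 2).toLp _ ω := by
    filter_upwards [hL] with ω h1
    rw [h1]
    exact le_max_right _ _
  have hmem : (hP.memLp 2).toLp _ ∈ K := by
    refine ⟨h0, ⟨C, hbd⟩, le_trans (hρ.mono _ _ (hX.sub (IsMeasBdd.of_Lp h0 hbd)) hY ?_) hρY⟩
    filter_upwards [hL] with ω h1
    rw [h1]
    linarith [le_max_left (X ω - Y ω) 0]
  refine (hW _ hmem ⟨C, hbd⟩).trans_eq (integral_congr_ae ?_)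
  filter_upwards [hL] with ω h1
  rw [h1]

/-- If `X` is not acceptable, some integrable function is nonpositive in mean on all acceptable
positions, and positive in mean on `X`. -/
theorem exists_integrable_separating [IsProbabilityMeasure ℙ] (hρ : IsFatouCoherent ℙ ρ)
    {X : Ω → ℝ} (hX : IsMeasBdd ℙ X) (hpos : 0 < ρ X) :
    ∃ D : Ω → ℝ, Measurable D ∧ Integrable D ℙ ∧ 0 < ∫ ω, D ω * X ω ∂ℙ ∧
      ∀ Y : Ω → ℝ, IsMeasBdd ℙ Y → ρ Y ≤ 0 → ∫ ω, D ω * Y ω ∂ℙ ≤ 0 := by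
  obtain ⟨W, hWm, hW0, hWi, hW⟩ := hρ.exists_weight hX hpos
  have hwm : Measurable fun ω => √(W ω) := hWm.sqrt
  have hw : MemLp (fun ω => √(W ω)) 2 ℙ := by
    rw [memLp_two_iff_integrable_sq hwm.aestronglyMeasurable]
    exact hWi.congr (.of_forall fun ω => (Real.sq_sqrt (hW0 ω)).symm)
  let Q : Set (Lp ℝ 2 ℙ) :=
    {v | ∃ Y : Ω → ℝ, IsMeasBdd ℙ Y ∧ ρ Y ≤ 0 ∧ v =ᵐ[ℙ] fun ω => √(W ω) * Y ω}
  have hsmul : ∀ v ∈ Q, ∀ c : ℝ, 0 ≤ c → c • v ∈ Q := by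
    rintro v ⟨Y, hY, hρY, hv⟩ c hc
    refine ⟨fun ω => c * Y ω, hY.const_mul c, ?_, ?_⟩
    · rw [hρ.const_mul Y hY c hc]
      exact mul_nonpos_of_nonneg_of_nonpos hc hρY
    · filter_upwards [hv, Lp.coeFn_smul c v] with ω h1 h2
      rw [h2, Pi.smul_apply, h1, smul_eq_mul]
      ring
  have hconv : Convex ℝ Q := by
    rintro v ⟨Y, hY, hρY, hv⟩ v' ⟨Y', hY', hρY', hv'⟩ a b ha hb hab
    obtain rfl : b = 1 - a := by linarith
    refine ⟨_, (hY.const_mul a).add (hY'.const_mul (1 - a)),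
      (hρ.convex Y Y' hY hY' a ha (by linarith)).trans (add_nonpos ?_ ?_), ?_⟩
    · exact mul_nonpos_of_nonneg_of_nonpos ha hρY
    · exact mul_nonpos_of_nonneg_of_nonpos hb hρY'
    · filter_upwards [hv, hv', Lp.coeFn_add (a • v) ((1 - a) • v'), Lp.coeFn_smul a v,
        Lp.coeFn_smul (1 - a) v'] with ω h1 h2 h3 h4 h5
      rw [h3, Pi.add_apply, h4, h5, Pi.smul_apply, Pi.smul_apply, h1, h2, smul_eq_mul, smul_eq_mul]
      ring
  have hmem : ∀ Y : Ω → ℝ, ∀ hY : IsMeasBdd ℙ Y, ρ Y ≤ 0 → (hY.memLp_mul hw).toLp _ ∈ Q :=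
    fun Y hY hρY => ⟨Y, hY, hρY, (hY.memLp_mul hw).coeFn_toLp⟩
  have hxw := hX.memLp_mul hw
  have hfar : ∀ v ∈ Q, 1 ≤ ‖hw.toLp _‖ * ‖hxw.toLp _ - v‖ := by
    rintro v ⟨Y, hY, hρY, hv⟩
    have hP := ((hX.sub hY).posPart).memLp_mul hw
    calc (1 : ℝ) ≤ ∫ ω, W ω * max (X ω - Y ω) 0 ∂ℙ := hW Y hY hρY
      _ = inner ℝ (hw.toLp _) (hP.toLp _) := by
        rw [real_inner_Lp_two_eq_integral_mul]
        refine integral_congr_ae ?_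
        filter_upwards [hw.coeFn_toLp, hP.coeFn_toLp] with ω h1 h2
        rw [h1, h2, ← mul_assoc, Real.mul_self_sqrt (hW0 ω)]
      _ ≤ ‖hw.toLp _‖ * ‖hP.toLp _‖ := real_inner_le_norm _ _
      _ ≤ ‖hw.toLp _‖ * ‖hxw.toLp _ - v‖ := by
        refine mul_le_mul_of_nonneg_left (Lp.norm_le_norm_of_ae_le ?_) (norm_nonneg _)
        filter_upwards [hP.coeFn_toLp, hxw.coeFn_toLp, hv, Lp.coeFn_sub (hxw.toLp _) v]
          with ω h1 h2 h3 h4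
        rw [h1, h4, Pi.sub_apply, h2, h3, ← mul_sub, norm_mul, norm_mul]
        refine mul_le_mul_of_nonneg_left ?_ (norm_nonneg _)
        rw [Real.norm_of_nonneg (le_max_right _ _)]
        exact max_le (le_abs_self _) (abs_nonneg _)
  have hnot : hxw.toLp _ ∉ closure Q := by
    intro h
    have hclosed : IsClosed {v : Lp ℝ 2 ℙ | 1 ≤ ‖hw.toLp _‖ * ‖hxw.toLp _ - v‖} :=
      isClosed_le continuous_const (by fun_prop)
    have h1 : (1 : ℝ) ≤ ‖hw.toLp _‖ * ‖hxw.toLp _ - hxw.toLp _‖ :=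
      closure_minimal hfar hclosed h
    rw [sub_self, norm_zero, mul_zero] at h1
    exact absurd h1 (by norm_num)
  obtain ⟨f, u, hfu, hux⟩ := geometric_hahn_banach_closed_point hconv.closure isClosed_closure hnot
  have h0Q : (0 : Lp ℝ 2 ℙ) ∈ Q := by
    simpa using hsmul _ (hmem _ (IsMeasBdd.const 0) (hρ.const 0).le) 0 le_rfl
  have hu : 0 < u := by simpa using hfu 0 (subset_closure h0Q)
  have hfQ : ∀ v ∈ Q, f v ≤ 0 := by
    intro v hv
    by_contra! h
    have := hfu _ (subset_closure (hsmul v hv (u / f v) (by positivity)))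
    rw [map_smul, smul_eq_mul, div_mul_cancel₀ _ h.ne'] at this
    exact lt_irrefl _ this
  set y := (InnerProductSpace.toDual ℝ (Lp ℝ 2 ℙ)).symm f with hy
  have hint : ∀ Y : Ω → ℝ, ∀ hY : IsMeasBdd ℙ Y,
      ∫ ω, y ω * √(W ω) * Y ω ∂ℙ = f ((hY.memLp_mul hw).toLp _) := by
    intro Y hY
    rw [← InnerProductSpace.toDual_symm_apply (𝕜 := ℝ), ← hy, real_inner_Lp_two_eq_integral_mul]
    refine integral_congr_ae ?_
    filter_upwards [(hY.memLp_mul hw).coeFn_toLp] with ω h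
    rw [h, mul_assoc]
  refine ⟨fun ω => y ω * √(W ω), (Lp.stronglyMeasurable y).measurable.mul hwm,
    (Lp.memLp y).integrable_mul hw, ?_, fun Y hY hρY => ?_⟩
  · rw [hint X hX]
    exact hu.trans hux
  · rw [hint Y hY]
    exact hfQ _ (hmem Y hY hρY)

/-- A position that is not acceptable has positive mean under some element of the supporting
set. -/
theorem exists_suppMem_pos [IsProbabilityMeasure ℙ] (hρ : IsFatouCoherent ℙ ρ)
    {X : Ω → ℝ} (hX : IsMeasBdd ℙ X) (hpos : 0 < ρ X) :
    ∃ D : Ω → ℝ, SuppMem ℙ ρ D ∧ 0 < ∫ ω, D ω * X ω ∂ℙ := by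
  classical
  obtain ⟨D, hDm, hDi, hDX, hD⟩ := hρ.exists_integrable_separating hX hpos
  have hDnn : 0 ≤ᵐ[ℙ] D := by
    refine ae_nonneg_of_forall_setIntegral_nonneg hDi fun s hs _ => ?_
    have hY : IsMeasBdd ℙ (s.indicator fun _ => (-1 : ℝ)) := by
      refine ⟨measurable_const.indicator hs, 1, .of_forall fun ω => ?_⟩
      rw [Set.indicator_apply]
      split_ifs <;> simp
    have hρY : ρ (s.indicator fun _ => (-1 : ℝ)) ≤ 0 := by
      refine (hρ.mono _ _ hY (IsMeasBdd.const 0) (.of_forall fun ω => ?_)).trans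
        (hρ.const 0).le
      rw [Set.indicator_apply]
      split_ifs <;> simp
    have h := hD _ hY hρY
    have heq : (fun ω => D ω * s.indicator (fun _ => (-1 : ℝ)) ω) =
        fun ω => -(s.indicator D ω) := by
      funext ω
      simp only [Set.indicator_apply]
      split_ifs <;> simp
    rw [heq, integral_neg, integral_indicator hs] at h
    linarith
  set c : ℝ := ∫ ω, D ω ∂ℙ with hc
  have hc0 : 0 ≤ c := integral_nonneg_of_ae hDnn
  obtain ⟨C, hC⟩ := hX.2
  have hXC : ∫ ω, D ω * X ω ∂ℙ ≤ c * C := by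
    rw [hc, ← integral_mul_const]
    refine integral_mono_ae (hX.integrable_mul hDi) (hDi.mul_const C) ?_
    filter_upwards [hDnn, hC] with ω h1 h2
    exact mul_le_mul_of_nonneg_left ((le_abs_self _).trans h2) h1
  have hcpos : 0 < c := by
    refine lt_of_le_of_ne hc0 fun h => ?_
    rw [← h, zero_mul] at hXC
    exact hXC.not_gt hDX
  have hscale : ∀ Y : Ω → ℝ, ∫ ω, c⁻¹ * D ω * Y ω ∂ℙ = c⁻¹ * ∫ ω, D ω * Y ω ∂ℙ := by
    intro Y
    rw [← integral_const_mul]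
    simp only [mul_assoc]
  refine ⟨fun ω => c⁻¹ * D ω, ⟨hDm.const_mul _, ?_, hDi.const_mul _, ?_, ?_⟩, ?_⟩
  · filter_upwards [hDnn] with ω h
    have : 0 ≤ D ω := h
    positivity
  · rw [integral_const_mul, ← hc, inv_mul_cancel₀ hcpos.ne']
  · intro Y hYm hYb
    have hY : IsMeasBdd ℙ Y := ⟨hYm, hYb⟩
    have h := hD _ (hY.add (IsMeasBdd.const (-ρ Y))) (by rw [hρ.add_const Y _ hY]; linarith)
    simp only [mul_add] at h
    rw [integral_add (hY.integrable_mul hDi) (hDi.mul_const _), integral_mul_const, ← hc] at h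
    rw [hscale, inv_mul_le_iff₀ hcpos]
    linarith
  · rw [hscale]
    positivity

/-- The robust representation: `ρ X` is approximated from below by the means of `X` under the
elements of the supporting set. -/
theorem exists_suppMem_lt [IsProbabilityMeasure ℙ] (hρ : IsFatouCoherent ℙ ρ)
    {X : Ω → ℝ} (hX : IsMeasBdd ℙ X) {c : ℝ} (hc : c < ρ X) :
    ∃ D : Ω → ℝ, SuppMem ℙ ρ D ∧ c < ∫ ω, D ω * X ω ∂ℙ := by
  obtain ⟨D, hD, hDX⟩ := hρ.exists_suppMem_pos (hX.add (IsMeasBdd.const (-c)))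
    (by rw [hρ.add_const X _ hX]; linarith)
  refine ⟨D, hD, ?_⟩
  obtain ⟨-, -, hDi, hD1, -⟩ := hD
  simp only [mul_add] at hDX
  rw [integral_add (hX.integrable_mul hDi) (hDi.mul_const _), integral_mul_const, hD1] at hDX
  linarith

end IsFatouCoherent

theorem IsMeasBdd.condExp {Ω : Type*} {m mΩ : MeasurableSpace Ω} (hm : m ≤ mΩ) {ℙ : Measure Ω}
    {X : Ω → ℝ} (hX : IsMeasBdd ℙ X) : IsMeasBdd ℙ (ℙ[X|m]) := by
  obtain ⟨-, C, hC⟩ := hX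
  exact ⟨(stronglyMeasurable_condExp.mono hm).measurable, C, ae_bdd_abs_condExp_of_ae_bdd_abs hC⟩

/-- Conditional expectation is self-adjoint. -/
theorem IsMeasBdd.integral_mul_condExp {Ω : Type*} {m mΩ : MeasurableSpace Ω} (hm : m ≤ mΩ)
    {ℙ : Measure Ω} [IsFiniteMeasure ℙ] {D X : Ω → ℝ} (hD : Integrable D ℙ)
    (hX : IsMeasBdd ℙ X) : ∫ ω, D ω * (ℙ[X|m]) ω ∂ℙ = ∫ ω, (ℙ[D|m]) ω * X ω ∂ℙ := by
  have h1 : ℙ[fun ω => D ω * (ℙ[X|m]) ω|m] =ᵐ[ℙ] fun ω => (ℙ[D|m]) ω * (ℙ[X|m]) ω :=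
    condExp_mul_of_stronglyMeasurable_right stronglyMeasurable_condExp
      ((hX.condExp hm).integrable_mul hD) hD
  have h2 : ℙ[fun ω => (ℙ[D|m]) ω * X ω|m] =ᵐ[ℙ] fun ω => (ℙ[D|m]) ω * (ℙ[X|m]) ω :=
    condExp_mul_of_stronglyMeasurable_left stronglyMeasurable_condExp
      (hX.integrable_mul integrable_condExp) ((hX.memLp 1).integrable le_rfl)
  rw [← integral_condExp hm, ← integral_condExp hm (f := fun ω => (ℙ[D|m]) ω * X ω)]
  exact integral_congr_ae (h1.trans h2.symm)

/-- If `ρ` only depends on conditional expectations, every supporting density is invariant under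
conditional expectation. -/
theorem SuppMem.ae_eq_condExp {Ω : Type*} {m mΩ : MeasurableSpace Ω} (hm : m ≤ mΩ)
    {ℙ : Measure Ω} [IsProbabilityMeasure ℙ] {ρ : (Ω → ℝ) → ℝ} (hρ : IsFatouCoherent ℙ ρ)
    (h : ∀ X : Ω → ℝ, IsMeasBdd ℙ X → ρ X = ρ (ℙ[X|m])) {D : Ω → ℝ} (hD : SuppMem ℙ ρ D) :
    D =ᵐ[ℙ] ℙ[D|m] := by
  classical
  obtain ⟨-, -, hDi, -, hDρ⟩ := hD
  have hle : ∀ X : Ω → ℝ, IsMeasBdd ℙ X →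
      ∫ ω, D ω * X ω ∂ℙ ≤ ∫ ω, D ω * (ℙ[X|m]) ω ∂ℙ := by
    intro X hX
    have hY := hX.sub (hX.condExp hm)
    have hXi : Integrable X ℙ := (hX.memLp 1).integrable le_rfl
    have hzero : ℙ[fun ω => X ω - (ℙ[X|m]) ω|m] =ᵐ[ℙ] fun _ => 0 := by
      have h1 : ℙ[X - ℙ[X|m]|m] =ᵐ[ℙ] ℙ[X|m] - ℙ[ℙ[X|m]|m] :=
        condExp_sub hXi integrable_condExp m
      rw [condExp_of_stronglyMeasurable hm stronglyMeasurable_condExp integrable_condExp] at h1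
      refine h1.trans (.of_forall fun ω => ?_)
      simp
    have h2 := hDρ _ hY.1 hY.2
    rw [h _ hY, hρ.congr_ae _ _ hzero, hρ.const 0] at h2
    simp only [mul_sub] at h2
    rw [integral_sub (hX.integrable_mul hDi) ((hX.condExp hm).integrable_mul hDi)] at h2
    linarith
  have heq : ∀ X : Ω → ℝ, IsMeasBdd ℙ X →
      ∫ ω, D ω * X ω ∂ℙ = ∫ ω, (ℙ[D|m]) ω * X ω ∂ℙ := by
    intro X hX
    have h1 := hle X hX
    have h2 := hle _ (hX.const_mul (-1))
    rw [IsMeasBdd.integral_mul_condExp hm hDi hX] at h1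
    rw [IsMeasBdd.integral_mul_condExp hm hDi (hX.const_mul (-1))] at h2
    simp only [mul_left_comm _ (-1 : ℝ)] at h2
    rw [integral_const_mul, integral_const_mul] at h2
    linarith
  refine Integrable.ae_eq_of_forall_setIntegral_eq D _ hDi integrable_condExp fun s hs _ => ?_
  have hY : IsMeasBdd ℙ (s.indicator fun _ => (1 : ℝ)) := by
    refine ⟨measurable_const.indicator hs, 1, .of_forall fun ω => ?_⟩
    rw [Set.indicator_apply]
    split_ifs <;> simp
  have hind : ∀ f : Ω → ℝ, ∫ ω, f ω * s.indicator (fun _ => (1 : ℝ)) ω ∂ℙ = ∫ ω in s, f ω ∂ℙ := by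
    intro f
    rw [← integral_indicator hs]
    congr 1
    funext ω
    simp only [Set.indicator_apply]
    split_ifs <;> simp
  rw [← hind, ← hind]
  exact heq _ hY

/-- If every supporting density is measurable with respect to a sub-σ-algebra, then `ρ` only
depends on the conditional expectation. -/
theorem IsFatouCoherent.eq_condExp {Ω : Type*} {m mΩ : MeasurableSpace Ω} (hm : m ≤ mΩ)
    {ℙ : Measure Ω} [IsProbabilityMeasure ℙ] {ρ : (Ω → ℝ) → ℝ} (hρ : IsFatouCoherent ℙ ρ)
    (h : ∀ D : Ω → ℝ, SuppMem ℙ ρ D → ∃ g : Ω → ℝ, StronglyMeasurable[m] g ∧ D =ᵐ[ℙ] g)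
    {X : Ω → ℝ} (hX : IsMeasBdd ℙ X) : ρ X = ρ (ℙ[X|m]) := by
  have hXm := hX.condExp hm
  have heq : ∀ D : Ω → ℝ, SuppMem ℙ ρ D →
      ∫ ω, D ω * (ℙ[X|m]) ω ∂ℙ = ∫ ω, D ω * X ω ∂ℙ := by
    intro D hD
    obtain ⟨g, hg, hDg⟩ := h D hD
    have hDi : Integrable D ℙ := hD.2.2.1
    rw [hX.integral_mul_condExp hm hDi]
    have h1 : ℙ[D|m] =ᵐ[ℙ] D := by
      refine (condExp_congr_ae hDg).trans ?_
      rw [condExp_of_stronglyMeasurable hm hg (hDi.congr hDg)]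
      exact hDg.symm
    refine integral_congr_ae ?_
    filter_upwards [h1] with ω hω
    rw [hω]
  refine le_antisymm (le_of_forall_lt fun c hc => ?_) (le_of_forall_lt fun c hc => ?_)
  · obtain ⟨D, hD, hcD⟩ := hρ.exists_suppMem_lt hX hc
    rw [← heq D hD] at hcD
    exact hcD.trans_le (hD.2.2.2.2 _ hXm.1 hXm.2)
  · obtain ⟨D, hD, hcD⟩ := hρ.exists_suppMem_lt hXm hc
    rw [heq D hD] at hcD
    exact hcD.trans_le (hD.2.2.2.2 _ hX.1 hX.2)

/-- for a Fatou coherent risk measure ρ, the following are equivalent: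
(i) ρ(X) = ρ̃(𝔼[X|𝓖]) for some ρ̃; (ii) ρ(X) = ρ(𝔼[X|𝓖]) for all X; (iii) every density in
the supporting set of ρ is (a.e. equal to) a 𝓖-measurable function. -/
theorem stmt_17 {Ω : Type*} (m : MeasurableSpace Ω) {mΩ : MeasurableSpace Ω} (hm : m ≤ mΩ)
    (ℙ : Measure Ω) [IsProbabilityMeasure ℙ] (ρ : (Ω → ℝ) → ℝ)
    (hae : ∀ X Y : Ω → ℝ, X =ᵐ[ℙ] Y → ρ X = ρ Y)
    (hcash : ∀ (X : Ω → ℝ) (c : ℝ), Measurable X → (∃ C : ℝ, ∀ᵐ ω ∂ℙ, |X ω| ≤ C) →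
      ρ (fun ω => X ω + c) = ρ X + c)
    (hmono : ∀ X Y : Ω → ℝ, Measurable X → (∃ C : ℝ, ∀ᵐ ω ∂ℙ, |X ω| ≤ C) → Measurable Y →
      (∃ C : ℝ, ∀ᵐ ω ∂ℙ, |Y ω| ≤ C) → (∀ᵐ ω ∂ℙ, X ω ≤ Y ω) → ρ X ≤ ρ Y)
    (hconv : ∀ X Y : Ω → ℝ, Measurable X → (∃ C : ℝ, ∀ᵐ ω ∂ℙ, |X ω| ≤ C) → Measurable Y →
      (∃ C : ℝ, ∀ᵐ ω ∂ℙ, |Y ω| ≤ C) → ∀ lam : ℝ, 0 ≤ lam → lam ≤ 1 →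
      ρ (fun ω => lam * X ω + (1 - lam) * Y ω) ≤ lam * ρ X + (1 - lam) * ρ Y)
    (hph : ∀ X : Ω → ℝ, Measurable X → (∃ C : ℝ, ∀ᵐ ω ∂ℙ, |X ω| ≤ C) → ∀ lam : ℝ, 0 ≤ lam →
      ρ (fun ω => lam * X ω) = lam * ρ X)
    (hFatou : ∀ (Xs : ℕ → Ω → ℝ) (X : Ω → ℝ) (C : ℝ), (∀ n, Measurable (Xs n)) →
      (∀ n ω, |Xs n ω| ≤ C) → Measurable X → (∀ ω, |X ω| ≤ C) →
      (∀ᵐ ω ∂ℙ, Filter.Tendsto (fun n => Xs n ω) Filter.atTop (nhds (X ω))) →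
      ρ X ≤ Filter.liminf (fun n => ρ (Xs n)) Filter.atTop) :
    ((∃ ρt : (Ω → ℝ) → ℝ, ∀ X : Ω → ℝ, Measurable X → (∃ C : ℝ, ∀ᵐ ω ∂ℙ, |X ω| ≤ C) →
        ρ X = ρt (ℙ[X|m]))
      ↔ (∀ X : Ω → ℝ, Measurable X → (∃ C : ℝ, ∀ᵐ ω ∂ℙ, |X ω| ≤ C) →
        ρ X = ρ (ℙ[X|m])))
    ∧ ((∀ X : Ω → ℝ, Measurable X → (∃ C : ℝ, ∀ᵐ ω ∂ℙ, |X ω| ≤ C) →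
        ρ X = ρ (ℙ[X|m]))
      ↔ (∀ D : Ω → ℝ, SuppMem ℙ ρ D →
        ∃ g : Ω → ℝ, StronglyMeasurable[m] g ∧ D =ᵐ[ℙ] g)) := by
  have hρ : IsFatouCoherent ℙ ρ :=
    { congr_ae := hae
      add_const := fun X c hX => hcash X c hX.1 hX.2
      mono := fun X Y hX hY => hmono X Y hX.1 hX.2 hY.1 hY.2
      convex := fun X Y hX hY => hconv X Y hX.1 hX.2 hY.1 hY.2
      const_mul := fun X hX => hph X hX.1 hX.2
      fatou := hFatou }
  refine ⟨⟨?_, fun h => ⟨ρ, h⟩⟩, ?_, ?_⟩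
  · rintro ⟨ρt, h⟩ X hXm hXb
    have hX : IsMeasBdd ℙ (ℙ[X|m]) := IsMeasBdd.condExp hm ⟨hXm, hXb⟩
    rw [h _ hX.1 hX.2, h X hXm hXb,
      condExp_of_stronglyMeasurable hm stronglyMeasurable_condExp integrable_condExp]
  · intro h D hD
    exact ⟨ℙ[D|m], stronglyMeasurable_condExp,
      hD.ae_eq_condExp hm hρ fun X hX => h X hX.1 hX.2⟩
  · intro h X hXm hXb
    exact hρ.eq_condExp hm h ⟨hXm, hXb⟩
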